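/- Jackson's summation formula for a terminating balanced very-well-poised ₈W₇: for n ∈ ℕ and nonzero complex numbers q, a, b, c, d with 0 < |q| < 1 such that no factor in the denominators below vanishes, ∑_{k=0}^n ((1 − a q^{2k})/(1 − a)) · ((a;q)_k (b;q)_k (c;q)_k (d;q)_k (q^{n+1}a²/(bcd);q)_k (q^{−n};q)_k) / ((q;q)_k (qa/b;q)_k (qa/c;q)_k (qa/d;q)_k (q^{−n}bcd/a;q)_k (q^{n+1}a;q)_k) · q^k = ((qa;q)_n (qa/(bc);q)_n (qa/(bd);q)_n (qa/(cd);q)_n) / ((qa/b;q)_n (qa/c;q)_n (qa/d;q)_n (qa/(bcd);q)_n). -/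

import Mathlib

/-- The finite `q`-shifted factorial `(a;q)_k`. -/
noncomputable def qPoch (a q : ℂ) (k : ℕ) : ℂ := ∏ j ∈ Finset.range k, (1 - a * q ^ j)

lemma qPoch_zero (x q : ℂ) : qPoch x q 0 = 1 := by simp [qPoch]

lemma qPoch_succ (x q : ℂ) (k : ℕ) : qPoch x q (k + 1) = qPoch x q k * (1 - x * q ^ k) := by
  simp [qPoch, Finset.prod_range_succ]

lemma qPoch_succ' (x q : ℂ) (k : ℕ) : qPoch x q (k + 1) = (1 - x) * qPoch (q * x) q k := by
  simp only [qPoch, Finset.prod_range_succ', pow_zero, mul_one]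
  rw [mul_comm]
  congr 1
  exact Finset.prod_congr rfl fun j _ => by ring

lemma qPoch_ne_zero_of_le {x q : ℂ} {k n : ℕ} (hkn : k ≤ n) (h : qPoch x q n ≠ 0) :
    qPoch x q k ≠ 0 := by
  rw [qPoch, Finset.prod_ne_zero_iff] at h ⊢
  exact fun j hj => h j (Finset.mem_range.2 ((Finset.mem_range.1 hj).trans_le hkn))

lemma qPoch_self_ne_zero {q : ℂ} (hq : ‖q‖ < 1) (k : ℕ) : qPoch q q k ≠ 0 := by
  rw [qPoch, Finset.prod_ne_zero_iff]
  intro j _ h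
  have h' : q ^ (j + 1) = 1 := by rw [pow_succ']; exact (sub_eq_zero.1 h).symm
  have : ‖q‖ ^ (j + 1) < 1 := pow_lt_one₀ (norm_nonneg q) hq (by omega)
  rw [← norm_pow, h', norm_one] at this
  exact lt_irrefl _ this

lemma qPoch_eq_zero {x q : ℂ} {n : ℕ} (h : x * q ^ n = 1) : qPoch x q (n + 1) = 0 := by
  rw [qPoch_succ, h, sub_self, mul_zero]

/-- The summand of the very-well-poised series with `q^{-n}` replaced by `z`, multiplied
by `1 - a`. -/
noncomputable def jacksonTerm (b c d q a z : ℂ) (k : ℕ) : ℂ :=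
  (1 - a * q ^ (2 * k)) *
    (qPoch a q k * qPoch b q k * qPoch c q k * qPoch d q k *
      qPoch (q * a ^ 2 / (b * c * d * z)) q k * qPoch z q k) /
    (qPoch q q k * qPoch (q * a / b) q k * qPoch (q * a / c) q k * qPoch (q * a / d) q k *
      qPoch (z * b * c * d / a) q k * qPoch (q * a / z) q k) * q ^ k

/-- The part of `jacksonTerm b c d q (q * a) (q * z) k` that contributes to
`jacksonTerm b c d q a z k`. -/
noncomputable def jacksonLower (b c d q a z : ℂ) (k : ℕ) : ℂ :=
  (1 - a) * (1 - a * q / (b * c * d * q ^ k)) *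
    (qPoch (q * a) q k * qPoch b q k * qPoch c q k * qPoch d q k *
      qPoch (q * (q * a ^ 2 / (b * c * d * z))) q k * qPoch (q * z) q k) /
    ((1 - q * a / (b * c * d)) * (qPoch q q k * qPoch (q * a / b) q k * qPoch (q * a / c) q k *
      qPoch (q * a / d) q k * qPoch (z * b * c * d / a) q k * qPoch (q * a / z) q k)) * q ^ k

/-- The part of `jacksonTerm b c d q (q * a) (q * z) k` that contributes to
`jacksonTerm b c d q a z (k + 1)`. -/
noncomputable def jacksonUpper (b c d q a z : ℂ) (k : ℕ) : ℂ :=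
  (1 - a) * (a * q / (b * c * d * q ^ k)) * (1 - a ^ 2 * q ^ (k + 2) / (b * c * d)) *
    (qPoch (q * a) q k * qPoch b q (k + 1) * qPoch c q (k + 1) * qPoch d q (k + 1) *
      qPoch (q * (q * a ^ 2 / (b * c * d * z))) q k * qPoch (q * z) q k) /
    ((1 - q * a / (b * c * d)) * (qPoch q q k * qPoch (q * a / b) q (k + 1) *
      qPoch (q * a / c) q (k + 1) * qPoch (q * a / d) q (k + 1) *
      qPoch (z * b * c * d / a) q k * qPoch (q * a / z) q k)) * q ^ k

section
variable {b c d q a z : ℂ}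

lemma jacksonTerm_zero (hm : 1 - q * a / (b * c * d) ≠ 0) :
    jacksonTerm b c d q a z 0 = jacksonLower b c d q a z 0 := by
  simp only [jacksonTerm, jacksonLower, qPoch_zero, pow_zero, mul_zero, mul_one, div_one]
  rw [mul_comm a q, mul_div_assoc, div_self hm, mul_one]

lemma jacksonTerm_succ (hq : q ≠ 0) (ha : a ≠ 0) (hb : b ≠ 0) (hc : c ≠ 0) (hd : d ≠ 0)
    (hz : z ≠ 0) (hm : 1 - q * a / (b * c * d) ≠ 0) (k : ℕ) (h0 : qPoch q q (k + 1) ≠ 0)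
    (h1 : qPoch (z * b * c * d / a) q (k + 1) ≠ 0) (h2 : qPoch (q * a / z) q (k + 1) ≠ 0) :
    jacksonTerm b c d q a z (k + 1) =
      jacksonLower b c d q a z (k + 1) + jacksonUpper b c d q a z k := by
  have hQ : q ^ k ≠ 0 := pow_ne_zero _ hq
  rw [qPoch_succ] at h0 h1 h2
  obtain ⟨h0, h0'⟩ := mul_ne_zero_iff.1 h0
  obtain ⟨h1, h1'⟩ := mul_ne_zero_iff.1 h1
  obtain ⟨h2, h2'⟩ := mul_ne_zero_iff.1 h2
  have key : (1 - a * q ^ (2 * (k + 1))) * (1 - q * a ^ 2 / (b * c * d * z)) * (1 - z) * q /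
        ((1 - q * q ^ k) * (1 - z * b * c * d / a * q ^ k) * (1 - q * a / z * q ^ k)) =
      (1 - a * q / (b * c * d * q ^ (k + 1))) * (1 - q * a * q ^ k) *
        (1 - q * (q * a ^ 2 / (b * c * d * z)) * q ^ k) * (1 - q * z * q ^ k) * q /
        ((1 - q * a / (b * c * d)) * ((1 - q * q ^ k) * (1 - z * b * c * d / a * q ^ k) *
          (1 - q * a / z * q ^ k))) +
      a * q / (b * c * d * q ^ k) * (1 - a ^ 2 * q ^ (k + 2) / (b * c * d)) /
        (1 - q * a / (b * c * d)) := by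
    have p1 : q ^ (2 * (k + 1)) = (q * q ^ k) ^ 2 := by ring
    have p2 : q ^ (k + 2) = q ^ 2 * q ^ k := by ring
    rw [p1, p2, pow_succ' q k]
    generalize q ^ k = Q at *
    rw [div_add_div _ _ (mul_ne_zero hm (mul_ne_zero (mul_ne_zero h0' h1') h2')) hm,
      div_eq_div_iff (mul_ne_zero (mul_ne_zero h0' h1') h2')
        (mul_ne_zero (mul_ne_zero hm (mul_ne_zero (mul_ne_zero h0' h1') h2')) hm)]
    field_simp
    ring
  have e0 : qPoch a q (k + 1) = _ := qPoch_succ' a q k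
  have e1 : qPoch (q * a ^ 2 / (b * c * d * z)) q (k + 1) = _ := qPoch_succ' _ q k
  have e2 : qPoch z q (k + 1) = _ := qPoch_succ' z q k
  unfold jacksonTerm jacksonLower jacksonUpper
  rw [e0, e1, e2, qPoch_succ (q * a), qPoch_succ (q * (q * a ^ 2 / (b * c * d * z))),
    qPoch_succ (q * z), qPoch_succ q, qPoch_succ (z * b * c * d / a), qPoch_succ (q * a / z)]
  rw [pow_succ q k] at key ⊢
  generalize qPoch (q * (q * a ^ 2 / (b * c * d * z))) q k = E at *
  generalize q * a ^ 2 / (b * c * d * z) = e at *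
  generalize a * q / (b * c * d * q ^ k) = s at *
  generalize a * q / (b * c * d * (q ^ k * q)) = s' at *
  generalize 1 - a ^ 2 * q ^ (k + 2) / (b * c * d) = t at *
  generalize 1 - q * a / (b * c * d) = m at *
  generalize 1 - z * b * c * d / a * q ^ k = m1 at *
  generalize 1 - q * a / z * q ^ k = m2 at *
  generalize 1 - q * q ^ k = m3 at *
  linear_combination (1 - a) * qPoch (q * a) q k * qPoch b q (k + 1) * qPoch c q (k + 1) *
    qPoch d q (k + 1) * E * qPoch (q * z) q k * q ^ k / (qPoch q q k *
    qPoch (q * a / b) q (k + 1) * qPoch (q * a / c) q (k + 1) * qPoch (q * a / d) q (k + 1) *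
      qPoch (z * b * c * d / a) q k * qPoch (q * a / z) q k) * key

lemma jacksonLower_add_jacksonUpper (hq : q ≠ 0) (ha : a ≠ 0) (hb : b ≠ 0) (hc : c ≠ 0)
    (hd : d ≠ 0) (hz : z ≠ 0) (k : ℕ)
    (h1 : qPoch (q * a / b) q (k + 1) ≠ 0) (h2 : qPoch (q * a / c) q (k + 1) ≠ 0)
    (h3 : qPoch (q * a / d) q (k + 1) ≠ 0) :
    jacksonLower b c d q a z k + jacksonUpper b c d q a z k =
      (1 - a) * (1 - q * a / (b * c)) * (1 - q * a / (b * d)) * (1 - q * a / (c * d)) /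
        ((1 - q * a / b) * (1 - q * a / c) * (1 - q * a / d) * (1 - q * a / (b * c * d))) *
        jacksonTerm b c d q (q * a) (q * z) k := by
  have hQ : q ^ k ≠ 0 := pow_ne_zero _ hq
  have e1 : qPoch (q * a / b) q (k + 1) = (1 - q * a / b) * qPoch (q * (q * a) / b) q k := by
    rw [qPoch_succ', mul_div_assoc q (q * a)]
  have e2 : qPoch (q * a / c) q (k + 1) = (1 - q * a / c) * qPoch (q * (q * a) / c) q k := by
    rw [qPoch_succ', mul_div_assoc q (q * a)]
  have e3 : qPoch (q * a / d) q (k + 1) = (1 - q * a / d) * qPoch (q * (q * a) / d) q k := by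
    rw [qPoch_succ', mul_div_assoc q (q * a)]
  have E : q * (q * a) ^ 2 / (b * c * d * (q * z)) = q * (q * a ^ 2 / (b * c * d * z)) := by
    field_simp
  have F : q * z * b * c * d / (q * a) = z * b * c * d / a := by field_simp
  have G : q * (q * a) / (q * z) = q * a / z := by field_simp
  have key : (1 - a * q / (b * c * d * q ^ k)) * ((1 - q * a / b * q ^ k) *
        (1 - q * a / c * q ^ k) * (1 - q * a / d * q ^ k)) +
      (a * q / (b * c * d * q ^ k)) * (1 - a ^ 2 * q ^ (k + 2) / (b * c * d)) *
        ((1 - b * q ^ k) * (1 - c * q ^ k) * (1 - d * q ^ k)) =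
      (1 - q * a / (b * c)) * (1 - q * a / (b * d)) * (1 - q * a / (c * d)) *
        (1 - q * a * q ^ (2 * k)) := by
    have p1 : q ^ (2 * k) = (q ^ k) ^ 2 := by ring
    have p2 : q ^ (k + 2) = q ^ 2 * q ^ k := by ring
    rw [p1, p2]
    generalize q ^ k = Q at *
    field_simp
    ring
  have f1 := (qPoch_succ (q * a / b) q k)
  have f2 := (qPoch_succ (q * a / c) q k)
  have f3 := (qPoch_succ (q * a / d) q k)
  have g1 : (qPoch (q * a / b) q k)⁻¹ =
      (1 - q * a / b * q ^ k) / qPoch (q * a / b) q (k + 1) := by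
    rw [f1] at h1 ⊢
    have := right_ne_zero_of_mul h1
    rw [div_mul_cancel_right₀ this]
  have g2 : (qPoch (q * a / c) q k)⁻¹ =
      (1 - q * a / c * q ^ k) / qPoch (q * a / c) q (k + 1) := by
    rw [f2] at h2 ⊢
    have := right_ne_zero_of_mul h2
    rw [div_mul_cancel_right₀ this]
  have g3 : (qPoch (q * a / d) q k)⁻¹ =
      (1 - q * a / d * q ^ k) / qPoch (q * a / d) q (k + 1) := by
    rw [f3] at h3 ⊢
    have := right_ne_zero_of_mul h3
    rw [div_mul_cancel_right₀ this]
  unfold jacksonTerm jacksonLower jacksonUpper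
  rw [E, F, G]
  rw [qPoch_succ b, qPoch_succ c, qPoch_succ d]
  rw [e1] at g1 ⊢
  rw [e2] at g2 ⊢
  rw [e3] at g3 ⊢
  clear e1 e2 e3 f1 f2 f3 h1 h2 h3 E F G
  generalize qPoch (q * a / b) q k = B1 at *
  generalize qPoch (q * a / c) q k = C1 at *
  generalize qPoch (q * a / d) q k = D1 at *
  generalize qPoch (q * (q * a) / b) q k = B2 at *
  generalize qPoch (q * (q * a) / c) q k = C2 at *
  generalize qPoch (q * (q * a) / d) q k = D2 at *
  generalize qPoch (q * (q * a ^ 2 / (b * c * d * z))) q k = E at *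
  generalize qPoch (z * b * c * d / a) q k = F at *
  generalize qPoch (q * a / z) q k = G at *
  generalize a * q / (b * c * d * q ^ k) = s at *
  generalize 1 - a ^ 2 * q ^ (k + 2) / (b * c * d) = t at *
  generalize 1 - q * a / (b * c * d) = m at *
  generalize 1 - q * a / (b * c) = u1 at *
  generalize 1 - q * a / (b * d) = u2 at *
  generalize 1 - q * a / (c * d) = u3 at *
  generalize 1 - q * a / b * q ^ k = y1 at *
  generalize 1 - q * a / c * q ^ k = y2 at *
  generalize 1 - q * a / d * q ^ k = y3 at *
  generalize 1 - q * a / b = x1 at *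
  generalize 1 - q * a / c = x2 at *
  generalize 1 - q * a / d = x3 at *
  simp only [div_eq_mul_inv, mul_inv, g1, g2, g3]
  linear_combination (1 - a) * qPoch (q * a) q k * qPoch b q k * qPoch c q k *
    qPoch d q k * E * qPoch (q * z) q k * q ^ k / (m * (qPoch q q k * (x1 * B2) * (x2 * C2) *
      (x3 * D2) * F * G)) * key

/-- Jackson's summation with `q^{-n}` replaced by `z`, multiplied by `1 - a`. -/
lemma sum_jacksonTerm (hq0 : q ≠ 0) (hq1 : ‖q‖ < 1) (hb : b ≠ 0) (hc : c ≠ 0) (hd : d ≠ 0)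
    (n : ℕ) : ∀ a z : ℂ, a ≠ 0 → z * q ^ n = 1 →
    qPoch (q * a / b) q n ≠ 0 → qPoch (q * a / c) q n ≠ 0 → qPoch (q * a / d) q n ≠ 0 →
    qPoch (z * b * c * d / a) q n ≠ 0 → qPoch (q * a / z) q n ≠ 0 →
    qPoch (q * a / (b * c * d)) q n ≠ 0 →
    ∑ k ∈ Finset.range (n + 1), jacksonTerm b c d q a z k =
      (1 - a) * (qPoch (q * a) q n * qPoch (q * a / (b * c)) q n * qPoch (q * a / (b * d)) q n *
        qPoch (q * a / (c * d)) q n /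
        (qPoch (q * a / b) q n * qPoch (q * a / c) q n * qPoch (q * a / d) q n *
          qPoch (q * a / (b * c * d)) q n)) := by
  induction n with
  | zero =>
    intro a z _ _ _ _ _ _ _ _
    simp [jacksonTerm, qPoch_zero]
  | succ n ih =>
    intro a z ha hzn h1 h2 h3 h4 h5 h6
    have hz : z ≠ 0 := left_ne_zero_of_mul_eq_one hzn
    have hzn' : q * z * q ^ n = 1 := by rw [← hzn]; ring
    have shift (x : ℂ) : qPoch (q * a / x) q (n + 1) =
        (1 - q * a / x) * qPoch (q * (q * a) / x) q n := by
      rw [qPoch_succ', mul_div_assoc q (q * a)]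
    have hm : 1 - q * a / (b * c * d) ≠ 0 := by
      rw [shift] at h6
      exact left_ne_zero_of_mul h6
    have hlast : jacksonLower b c d q a z (n + 1) = 0 := by
      rw [jacksonLower, qPoch_eq_zero hzn']
      simp
    have hF : q * z * b * c * d / (q * a) = z * b * c * d / a := by field_simp
    have hG : q * (q * a) / (q * z) = q * a / z := by field_simp
    have hih := ih (q * a) (q * z) (mul_ne_zero hq0 ha) hzn'
      (by rw [shift] at h1; exact right_ne_zero_of_mul h1)
      (by rw [shift] at h2; exact right_ne_zero_of_mul h2)
      (by rw [shift] at h3; exact right_ne_zero_of_mul h3)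
      (by rw [hF]; exact qPoch_ne_zero_of_le n.le_succ h4)
      (by rw [hG]; exact qPoch_ne_zero_of_le n.le_succ h5)
      (by rw [shift] at h6; exact right_ne_zero_of_mul h6)
    calc ∑ k ∈ Finset.range (n + 1 + 1), jacksonTerm b c d q a z k
        = ∑ k ∈ Finset.range (n + 1),
            (jacksonLower b c d q a z (k + 1) + jacksonUpper b c d q a z k) +
            jacksonLower b c d q a z 0 := by
          rw [Finset.sum_range_succ', jacksonTerm_zero hm]
          congr 1
          refine Finset.sum_congr rfl fun k hk => ?_
          have hk' : k + 1 ≤ n + 1 := Finset.mem_range.1 hk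
          exact jacksonTerm_succ hq0 ha hb hc hd hz hm k (qPoch_self_ne_zero hq1 _)
            (qPoch_ne_zero_of_le hk' h4) (qPoch_ne_zero_of_le hk' h5)
      _ = ∑ k ∈ Finset.range (n + 1),
            (jacksonLower b c d q a z k + jacksonUpper b c d q a z k) := by
          have h := Finset.sum_range_succ' (jacksonLower b c d q a z) (n + 1)
          rw [Finset.sum_range_succ, hlast] at h
          rw [Finset.sum_add_distrib, Finset.sum_add_distrib]
          linear_combination -h
      _ = (1 - a) * (1 - q * a / (b * c)) * (1 - q * a / (b * d)) * (1 - q * a / (c * d)) /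
            ((1 - q * a / b) * (1 - q * a / c) * (1 - q * a / d) * (1 - q * a / (b * c * d))) *
            ∑ k ∈ Finset.range (n + 1), jacksonTerm b c d q (q * a) (q * z) k := by
          rw [Finset.mul_sum]
          refine Finset.sum_congr rfl fun k hk => ?_
          have hk' : k + 1 ≤ n + 1 := Finset.mem_range.1 hk
          exact jacksonLower_add_jacksonUpper hq0 ha hb hc hd hz k (qPoch_ne_zero_of_le hk' h1)
            (qPoch_ne_zero_of_le hk' h2) (qPoch_ne_zero_of_le hk' h3)
      _ = _ := by
          rw [hih]
          simp only [shift]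
          rw [qPoch_succ' (q * a)]
          simp only [div_eq_mul_inv, mul_inv]
          ring

end

/-- Jackson's summation formula for a terminating balanced very-well-poised `₈W₇`:
`₈W₇(a; b, c, d, q^{n+1}a²/(bcd), q^{−n}; q, q)
  = ((qa;q)_n (qa/(bc);q)_n (qa/(bd);q)_n (qa/(cd);q)_n)
    / ((qa/b;q)_n (qa/c;q)_n (qa/d;q)_n (qa/(bcd);q)_n)`,
with the very-well-poised series written out explicitly; `0 < ‖q‖ < 1`, `a,b,c,d ≠ 0`,
`a ≠ 1`, and no factor in the denominators vanishes. -/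
theorem jackson_8W7_summation (n : ℕ) (q a b c d : ℂ) (hq0 : 0 < ‖q‖) (hq1 : ‖q‖ < 1)
    (ha : a ≠ 0) (hb : b ≠ 0) (hc : c ≠ 0) (hd : d ≠ 0) (ha1 : a ≠ 1)
    (h1 : qPoch (q * a / b) q n ≠ 0) (h2 : qPoch (q * a / c) q n ≠ 0)
    (h3 : qPoch (q * a / d) q n ≠ 0)
    (h4 : qPoch (q ^ (-(n : ℤ)) * b * c * d / a) q n ≠ 0)
    (h5 : qPoch (q ^ (n + 1) * a) q n ≠ 0)
    (h6 : qPoch (q * a / (b * c * d)) q n ≠ 0) :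
    ∑ k ∈ Finset.range (n + 1),
        (1 - a * q ^ (2 * k)) / (1 - a) *
          (qPoch a q k * qPoch b q k * qPoch c q k * qPoch d q k *
            qPoch (q ^ (n + 1) * a ^ 2 / (b * c * d)) q k * qPoch (q ^ (-(n : ℤ))) q k) /
          (qPoch q q k * qPoch (q * a / b) q k * qPoch (q * a / c) q k *
            qPoch (q * a / d) q k * qPoch (q ^ (-(n : ℤ)) * b * c * d / a) q k *
            qPoch (q ^ (n + 1) * a) q k) * q ^ k
      = qPoch (q * a) q n * qPoch (q * a / (b * c)) q n * qPoch (q * a / (b * d)) q n *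
          qPoch (q * a / (c * d)) q n /
          (qPoch (q * a / b) q n * qPoch (q * a / c) q n * qPoch (q * a / d) q n *
            qPoch (q * a / (b * c * d)) q n) := by
  have hq : q ≠ 0 := norm_pos_iff.1 hq0
  have hz : q ^ (-(n : ℤ)) * q ^ n = 1 := by
    rw [zpow_neg, zpow_natCast, inv_mul_cancel₀ (pow_ne_zero n hq)]
  have hG : q * a / q ^ (-(n : ℤ)) = q ^ (n + 1) * a := by
    rw [zpow_neg, zpow_natCast, div_inv_eq_mul]
    ring
  have hE : q * a ^ 2 / (b * c * d * q ^ (-(n : ℤ))) = q ^ (n + 1) * a ^ 2 / (b * c * d) := by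
    rw [zpow_neg, zpow_natCast]
    field_simp
    ring
  have h := sum_jacksonTerm hq hq1 hb hc hd n a _ ha hz h1 h2 h3 h4 (by rwa [hG]) h6
  rw [← mul_right_inj' (sub_ne_zero.2 ha1.symm), ← h, Finset.mul_sum]
  refine Finset.sum_congr rfl fun k _ => ?_
  have ha1' : 1 - a ≠ 0 := sub_ne_zero.2 ha1.symm
  rw [jacksonTerm, hE, hG, ← mul_assoc, ← mul_div_assoc, ← mul_assoc, mul_div_cancel₀ _ ha1']
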